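/- Let (R,F,μ) be a run-based probability system in which agent j has perfect recall. Then agent j maintains run-based probabilistic secrecy with respect to i if and only if for every j-local set S of points there exists a constant σ such that μ(R(S) | R(K_i(r,m))) = σ for every point (r,m). (Under perfect recall of j, R(S) is a disjoint union of countably many sets of the form R(K_j(r',m')), hence lies in F; in the standard probability system determined by (R,F,μ), the quantity μ(R(S) | R(K_i(r,m))) is the value of Pr_i(⟐φ) at (r,m) for a j-local formula φ whose extension is S.) -/

import Mathlib

open MeasureTheory
open scoped ENNReal

namespace Paper

variable {G LI LJ : Type*}

/-- The set of points of the system `R`: pairs of a run in `R` and a time. -/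
def ptsOf (R : Set (ℕ → G)) : Set ((ℕ → G) × ℕ) := {p | p.1 ∈ R}

/-- The information set, at the point `p`, of the agent whose local-state projection is `v`. -/
def infoSet {L : Type*} (R : Set (ℕ → G)) (v : (ℕ → G) → ℕ → L) (p : (ℕ → G) × ℕ) :
    Set ((ℕ → G) × ℕ) :=
  {q | q.1 ∈ R ∧ v q.1 q.2 = v p.1 p.2}

/-- `R(U)`: the runs of `R` going through a point of `U`. -/
def runsThrough (R : Set (ℕ → G)) (U : Set ((ℕ → G) × ℕ)) : Set (ℕ → G) :=
  {r | r ∈ R ∧ ∃ m : ℕ, (r, m) ∈ U}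

/-- A set `S` of points is local for the agent with local-state projection `v`. -/
def IsLocalSet {L : Type*} (R : Set (ℕ → G)) (v : (ℕ → G) → ℕ → L)
    (S : Set ((ℕ → G) × ℕ)) : Prop :=
  S ⊆ ptsOf R ∧ ∀ p q : (ℕ → G) × ℕ, p ∈ ptsOf R → q ∈ ptsOf R →
    v p.1 p.2 = v q.1 q.2 → (p ∈ S ↔ q ∈ S)

/-- The local-state sequence of the agent with local-state projection `v` at `(r,m)`. -/
noncomputable def lsSeq {L : Type*} (v : (ℕ → G) → ℕ → L) (r : ℕ → G) (m : ℕ) : List L :=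
  letI : DecidableRel fun a b : L => a ≠ b := fun _ _ => Classical.dec _
  ((List.range (m + 1)).map (v r)).destutter (· ≠ ·)

/-- The agent with local-state projection `v` has perfect recall in `R`. -/
def PerfectRecall {L : Type*} (R : Set (ℕ → G)) (v : (ℕ → G) → ℕ → L) : Prop :=
  ∀ p q : (ℕ → G) × ℕ, p ∈ ptsOf R → q ∈ infoSet R v p →
    lsSeq v q.1 q.2 = lsSeq v p.1 p.2

theorem mem_destutter'_ne_iff {α : Type*} [DecidableRel fun a b : α => a ≠ b] {x a : α}
    {l : List α} : x ∈ l.destutter' (· ≠ ·) a ↔ x ∈ a :: l := by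
  induction l generalizing a with
  | nil => simp
  | cons b l ih =>
    rw [List.destutter'_cons]
    split_ifs with h
    · rw [List.mem_cons, ih, List.mem_cons (l := b :: l)]
    · obtain rfl : a = b := not_not.mp h
      rw [ih]
      simp

theorem mem_lsSeq {L : Type*} {v : (ℕ → G) → ℕ → L} {r : ℕ → G} {m : ℕ} {x : L} :
    x ∈ lsSeq v r m ↔ ∃ k ≤ m, v r k = x := by
  let : DecidableRel fun a b : L => a ≠ b := fun _ _ => Classical.dec _
  unfold lsSeq
  rw [List.range_succ_eq_map, List.map_cons, List.destutter_cons', mem_destutter'_ne_iff,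
    ← List.map_cons, ← List.range_succ_eq_map]
  simp

theorem runsThrough_mono {R : Set (ℕ → G)} {U V : Set ((ℕ → G) × ℕ)} (h : U ⊆ V) :
    runsThrough R U ⊆ runsThrough R V :=
  fun _ ⟨hr, m, hm⟩ => ⟨hr, m, h hm⟩

theorem isLocalSet_infoSet {L : Type*} (R : Set (ℕ → G)) (v : (ℕ → G) → ℕ → L)
    (p : (ℕ → G) × ℕ) : IsLocalSet R v (infoSet R v p) := by
  refine ⟨fun q hq => hq.1, fun a b ha hb hab => ?_⟩
  have ha' : a.1 ∈ R := ha
  have hb' : b.1 ∈ R := hb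
  simp [infoSet, ha', hb', hab]

theorem IsLocalSet.infoSet_subset {L : Type*} {R : Set (ℕ → G)} {v : (ℕ → G) → ℕ → L}
    {S : Set ((ℕ → G) × ℕ)} (hS : IsLocalSet R v S) {p : (ℕ → G) × ℕ} (hp : p ∈ S) :
    infoSet R v p ⊆ S :=
  fun q hq => (hS.2 q p hq.1 (hS.1 hp) hq.2).mpr hp

/-- The points of `S` at which the agent has previously been in no other local state of `S`. -/
def firstPts {L : Type*} (v : (ℕ → G) → ℕ → L) (S : Set ((ℕ → G) × ℕ)) : Set ((ℕ → G) × ℕ) :=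
  {p | p ∈ S ∧ ∀ k ≤ p.2, (p.1, k) ∈ S → v p.1 k = v p.1 p.2}

theorem exists_mem_firstPts {L : Type*} (v : (ℕ → G) → ℕ → L) {S : Set ((ℕ → G) × ℕ)}
    {r : ℕ → G} (h : ∃ m, (r, m) ∈ S) : ∃ m, (r, m) ∈ firstPts v S := by
  classical
  refine ⟨Nat.find h, Nat.find_spec h, fun k hk hkS => ?_⟩
  rw [le_antisymm hk (Nat.find_min' h hkS)]

theorem PerfectRecall.isLocalSet_firstPts {L : Type*} {R : Set (ℕ → G)}
    {v : (ℕ → G) → ℕ → L} (hv : PerfectRecall R v) {S : Set ((ℕ → G) × ℕ)}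
    (hS : IsLocalSet R v S) : IsLocalSet R v (firstPts v S) := by
  have key : ∀ p q : (ℕ → G) × ℕ, p ∈ ptsOf R → q ∈ ptsOf R → v p.1 p.2 = v q.1 q.2 →
      p ∈ firstPts v S → q ∈ firstPts v S := by
    intro p q hp hq hpq hpT
    refine ⟨(hS.2 p q hp hq hpq).mp hpT.1, fun k hk hkS => ?_⟩
    have hmem : v q.1 k ∈ lsSeq v p.1 p.2 :=
      hv p q hp ⟨hq, hpq.symm⟩ ▸ mem_lsSeq.mpr ⟨k, hk, rfl⟩
    obtain ⟨l, hl, hlk⟩ := mem_lsSeq.mp hmem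
    rw [← hlk, ← hpq]
    exact hpT.2 l hl ((hS.2 (p.1, l) (q.1, k) hp hq hlk).mpr hkS)
  exact ⟨fun p hp => hS.1 hp.1,
    fun p q hp hq hpq => ⟨key p q hp hq hpq, key q p hq hp hpq.symm⟩⟩

/-- Under perfect recall, the runs through a local set are a disjoint union of sets of runs
through information sets. -/
theorem PerfectRecall.exists_pairwiseDisjoint_sUnion_eq {L : Type*} {R : Set (ℕ → G)}
    {v : (ℕ → G) → ℕ → L} (hv : PerfectRecall R v) {S : Set ((ℕ → G) × ℕ)}
    (hS : IsLocalSet R v S) :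
    ∃ C ⊆ (fun p => runsThrough R (infoSet R v p)) '' ptsOf R,
      C.PairwiseDisjoint id ∧ ⋃₀ C = runsThrough R S := by
  have hT := hv.isLocalSet_firstPts hS
  refine ⟨(fun p => runsThrough R (infoSet R v p)) '' firstPts v S, Set.image_mono hT.1, ?_, ?_⟩
  · rintro _ ⟨p, hp, rfl⟩ _ ⟨q, hq, rfl⟩ hne
    refine Set.disjoint_left.mpr fun r ⟨_, m, hm⟩ ⟨_, n, hn⟩ => hne ?_
    have hm' := hT.infoSet_subset hp hm
    have hn' := hT.infoSet_subset hq hn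
    have hmn : v r m = v r n := by
      rcases le_total m n with h | h
      · exact hn'.2 m h hm'.1
      · exact (hm'.2 n h hn'.1).symm
    have hpq : v p.1 p.2 = v q.1 q.2 := hm.2.symm.trans (hmn.trans hn.2)
    simp only [infoSet, hpq]
  · refine subset_antisymm ?_ fun r ⟨hr, hm⟩ => ?_
    · rintro r ⟨_, ⟨p, hp, rfl⟩, hr⟩
      exact runsThrough_mono (hS.infoSet_subset hp.1) hr
    · obtain ⟨n, hn⟩ := exists_mem_firstPts v hm
      exact ⟨_, ⟨(r, n), hn, rfl⟩, hr, n, hr, rfl⟩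

theorem countable_of_pairwiseDisjoint_of_measure_pos {α : Type*} [MeasurableSpace α]
    {μ : Measure α} [SFinite μ] {C : Set (Set α)} (hC : C.PairwiseDisjoint id)
    (hmeas : ∀ s ∈ C, MeasurableSet s) (hpos : ∀ s ∈ C, 0 < μ s) : C.Countable := by
  have h := Measure.countable_meas_pos_of_disjoint_iUnion (μ := μ)
    (As := fun s : C => (s : Set α)) (fun s => hmeas s s.2)
    fun s t hst => hC s.2 t.2 (Subtype.coe_injective.ne hst)
  have huniv : {s : C | 0 < μ (s : Set α)} = Set.univ :=
    Set.eq_univ_of_forall fun s => hpos s s.2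
  rw [huniv, Set.countable_univ_iff] at h
  exact h

theorem measure_sUnion_inter_div {α : Type*} [MeasurableSpace α] (μ : Measure α)
    {C : Set (Set α)} (hcount : C.Countable) (hC : C.PairwiseDisjoint id)
    (hmeas : ∀ s ∈ C, MeasurableSet s) (B : Set α) :
    μ (⋃₀ C ∩ B) / μ B = ∑' s : C, μ (s ∩ B) / μ B := by
  simp only [div_eq_mul_inv]
  rw [ENNReal.tsum_mul_right, ← Measure.restrict_apply (.sUnion hcount hmeas),
    measure_sUnion hcount hC hmeas]
  congr 1
  exact tsum_congr fun s => Measure.restrict_apply (hmeas s s.2)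

/-- in a run-based probability system `(R,F,μ)` in which agent `j` has
perfect recall, agent `j` maintains run-based probabilistic secrecy with respect to `i`
iff for every `j`-local set `S` there is a constant `σ` with
`μ(R(S) | R(K_i(r,m))) = σ` for every point `(r,m)`. -/
theorem runBasedProbSecrecy_iff_constant_on_jLocal (R : Set (ℕ → G)) (hR : R.Nonempty)
    (vi : (ℕ → G) → ℕ → LI) (vj : (ℕ → G) → ℕ → LJ)
    (hprj : PerfectRecall R vj)
    [MeasurableSpace (ℕ → G)] (μ : Measure (ℕ → G)) [IsProbabilityMeasure μ]
    (hfull : μ R = 1)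
    (hmeasI : ∀ p ∈ ptsOf R, MeasurableSet (runsThrough R (infoSet R vi p)) ∧
      0 < μ (runsThrough R (infoSet R vi p)))
    (hmeasJ : ∀ p ∈ ptsOf R, MeasurableSet (runsThrough R (infoSet R vj p)) ∧
      0 < μ (runsThrough R (infoSet R vj p))) :
    (∀ p ∈ ptsOf R, ∀ p' ∈ ptsOf R, ∀ q ∈ ptsOf R,
        μ (runsThrough R (infoSet R vj q) ∩ runsThrough R (infoSet R vi p)) /
            μ (runsThrough R (infoSet R vi p)) =
          μ (runsThrough R (infoSet R vj q) ∩ runsThrough R (infoSet R vi p')) /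
            μ (runsThrough R (infoSet R vi p'))) ↔
      (∀ S : Set ((ℕ → G) × ℕ), IsLocalSet R vj S →
        ∃ σ : ℝ≥0∞, ∀ p ∈ ptsOf R,
          μ (runsThrough R S ∩ runsThrough R (infoSet R vi p)) /
              μ (runsThrough R (infoSet R vi p)) = σ) := by
  constructor
  · intro h S hS
    obtain ⟨r₀, hr₀⟩ := hR
    obtain ⟨C, hCsub, hC, hCS⟩ := hprj.exists_pairwiseDisjoint_sUnion_eq hS
    have hCmeas : ∀ s ∈ C, MeasurableSet s ∧ 0 < μ s := by
      intro s hs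
      obtain ⟨q, hq, rfl⟩ := hCsub hs
      exact hmeasJ q hq
    have hcount : C.Countable := countable_of_pairwiseDisjoint_of_measure_pos hC
      (fun s hs => (hCmeas s hs).1) fun s hs => (hCmeas s hs).2
    refine ⟨∑' s : C, μ (s ∩ runsThrough R (infoSet R vi (r₀, 0))) /
      μ (runsThrough R (infoSet R vi (r₀, 0))), fun p hp => ?_⟩
    rw [← hCS, measure_sUnion_inter_div μ hcount hC fun s hs => (hCmeas s hs).1]
    refine tsum_congr fun s => ?_
    obtain ⟨q, hq, hqs⟩ := hCsub s.2
    rw [← hqs]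
    exact h p hp (r₀, 0) hr₀ q hq
  · intro h p hp p' hp' q _
    obtain ⟨σ, hσ⟩ := h _ (isLocalSet_infoSet R vj q)
    rw [hσ p hp, hσ p' hp']

end Paper
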